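/- arXiv:2004.04939 — 2 statements merged into one kernel-verified Lean document; each statement's English description precedes it below -/
import Mathlib

section
/- For all i, j ∈ I with a(i,j) = −1, the endomorphisms T_i and T_j of K_t(A) satisfy the braid relation: T_i ∘ T_j ∘ T_i = T_j ∘ T_i ∘ T_j. -/
noncomputable section

/-- The base field `F = ℂ(s)`, rational functions over `ℂ` in one variable `s`. -/
abbrev F : Type := RatFunc ℂ

/-- `t^{1/2} := s`. -/
def tHalf : F := RatFunc.X

/-- `t := s^2`. -/
def tq : F := RatFunc.X ^ 2

/-- `A = (a i j)` is the Cartan matrix of a finite-dimensional simply-laced simple Lie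
algebra of type ADE: a symmetric positive-definite integer matrix with diagonal entries `2`
and off-diagonal entries in `{0, -1}`. -/
def IsCartanADE {I : Type} [Fintype I] (a : I → I → ℤ) : Prop :=
  (∀ i, a i i = 2) ∧ (∀ i j, a i j = a j i) ∧
    (∀ i j, i ≠ j → a i j = 0 ∨ a i j = -1) ∧
    Matrix.PosDef (Matrix.of fun i j : I => (a i j : ℝ))

variable {I : Type} [Fintype I] [DecidableEq I]

/-- The generator `y(i,m)` of the free algebra. -/
def X (i : I) (m : ℤ) : FreeAlgebra F (I × ℤ) := FreeAlgebra.ι F (i, m)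

/-- The defining relations (a), (b), (c) of the quantum Grothendieck ring `K_t(A)`:
(a) quantum Serre relations in each copy, (b) `t`-boson relations between adjacent
copies, (c) `t`-commutation relations between non-adjacent copies. -/
inductive KtRel (a : I → I → ℤ) :
    FreeAlgebra F (I × ℤ) → FreeAlgebra F (I × ℤ) → Prop
  | comm0 {i j : I} {m : ℤ} (h : a i j = 0) :
      KtRel a (X i m * X j m) (X j m * X i m)
  | serre {i j : I} {m : ℤ} (h : a i j = -1) :
      KtRel a (X i m ^ 2 * X j m + X j m * X i m ^ 2)
        ((tq + tq⁻¹) • (X i m * X j m * X i m))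
  | boson (i j : I) (m : ℤ) :
      KtRel a (X i m * X j (m + 1))
        ((tq ^ (a i j)) • (X j (m + 1) * X i m)
          + (if i = j then ((1 : F) - tq ^ 2) • (1 : FreeAlgebra F (I × ℤ)) else 0))
  | tcomm {i j : I} {m p : ℤ} (h : p > m + 1) :
      KtRel a (X i m * X j p)
        ((tq ^ ((((-1 : ℤˣ) ^ (p - m + 1) : ℤˣ) : ℤ) * a i j)) • (X j p * X i m))

/-- The quantum Grothendieck ring `K_t(A)`. -/
abbrev Kt (a : I → I → ℤ) := RingQuot (KtRel a)

/-- The generators `y(i,m)` of `K_t(A)`. -/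
def y (a : I → I → ℤ) (i : I) (m : ℤ) : Kt a :=
  RingQuot.mkAlgHom F (KtRel a) (X i m)

/-- `z(i; j, m) := (t^{1/2} y(j,m) y(i,m) − t^{−1/2} y(i,m) y(j,m)) / (t − t^{−1})`. -/
def z (a : I → I → ℤ) (i j : I) (m : ℤ) : Kt a :=
  (tq - tq⁻¹)⁻¹ • (tHalf • (y a j m * y a i m) - tHalf⁻¹ • (y a i m * y a j m))

/-- `T` satisfies the defining formulas of the braid-group generator `T_i` on `K_t(A)`:
`T(y(j,m)) = y(j, m + δ_{ij})` if `a i j ≠ -1`, and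
`T(y(j,m)) = (t^{1/2} y(j,m) y(i,m) − t^{−1/2} y(i,m) y(j,m)) / (t − t^{−1})`
if `a i j = -1`. -/
def TiFormula (a : I → I → ℤ) (i : I) (T : Kt a → Kt a) : Prop :=
  ∀ (j : I) (m : ℤ),
    T (y a j m) =
      if a i j = -1 then z a i j m else y a j (m + if i = j then 1 else 0)

/-- `T` satisfies the defining formulas of the inverse braid-group generator `T_i'`:
`T(y(j,m)) = y(j, m − δ_{ij})` if `a i j ≠ -1`, and
`T(y(j,m)) = (t^{1/2} y(i,m) y(j,m) − t^{−1/2} y(j,m) y(i,m)) / (t − t^{−1})`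
if `a i j = -1`. -/
def TiInvFormula (a : I → I → ℤ) (i : I) (T : Kt a → Kt a) : Prop :=
  ∀ (j : I) (m : ℤ),
    T (y a j m) =
      if a i j = -1 then
        (tq - tq⁻¹)⁻¹ • (tHalf • (y a i m * y a j m) - tHalf⁻¹ • (y a j m * y a i m))
      else y a j (m - if i = j then 1 else 0)

/-- Abstract computation behind `T_i T_j y(i,m) = y(j,m)`. -/
theorem aux_rank_two {K R : Type*} [Field K] [Ring R] [Algebra K R] (s t : K) (hs : s ≠ 0)
    (ht : t = s ^ 2) (hc : t ^ 2 - 1 ≠ 0) (x w x' : R)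
    (h1 : x * x' = (t ^ 2) • (x' * x) + (1 - t ^ 2) • (1 : R))
    (h2 : w * x' = t⁻¹ • (x' * w)) :
    (t - t⁻¹)⁻¹ • (s • (x' * ((t - t⁻¹)⁻¹ • (s • (w * x) - s⁻¹ • (x * w))))
      - s⁻¹ • (((t - t⁻¹)⁻¹ • (s • (w * x) - s⁻¹ • (x * w))) * x')) = w := by
  have ht0 : t ≠ 0 := by rw [ht]; positivity
  have e : (t - t⁻¹)⁻¹ = t / (t ^ 2 - 1) := by
    have : t - t⁻¹ = (t ^ 2 - 1) / t := by field_simp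
    rw [this, inv_div]
  have h3 : w * (x * x') = (t ^ 2 * t⁻¹) • (x' * (w * x)) + (1 - t ^ 2) • w := by
    rw [h1, mul_add, mul_smul_comm, mul_smul_comm, ← mul_assoc, h2, smul_mul_assoc, smul_smul,
      mul_one, mul_assoc]
  have h4 : x * (w * x') = (t ^ 2 * t⁻¹) • (x' * (x * w)) + (t⁻¹ * (1 - t ^ 2)) • w := by
    rw [h2, mul_smul_comm, ← mul_assoc, h1, add_mul, smul_mul_assoc, smul_mul_assoc, one_mul,
      smul_add, smul_smul, smul_smul, mul_assoc, mul_comm (t⁻¹) (t ^ 2)]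
  rw [e]
  simp only [smul_mul_assoc, mul_smul_comm, sub_mul, mul_sub, mul_assoc, h3, h4]
  subst ht
  have hc' : s ^ 4 - 1 ≠ 0 := by
    rw [← pow_mul] at hc
    exact hc
  have e4 : (s ^ 2) ^ 2 = s ^ 4 := by ring
  simp only [e4]
  match_scalars <;> field_simp <;> ring

/-- Abstract computation for a third vertex. -/
theorem aux_third {K R : Type*} [Field K] [Ring R] [Algebra K R] (s c : K)
    (x w k : R) (h : w * k = k * w) :
    c • (s • ((c • (s • (k * x) - s⁻¹ • (x * k))) * w)
      - s⁻¹ • (w * (c • (s • (k * x) - s⁻¹ • (x * k)))))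
    = c • (s • (k * (c • (s • (x * w) - s⁻¹ • (w * x))))
      - s⁻¹ • ((c • (s • (x * w) - s⁻¹ • (w * x))) * k)) := by
  have h2 : w * (k * x) = k * (w * x) := by rw [← mul_assoc, h, mul_assoc]
  simp only [smul_mul_assoc, mul_smul_comm, sub_mul, mul_sub, mul_assoc, h, h2]
  by_cases hs : s = 0
  · subst hs; simp
  · module

theorem tHalf_ne : tHalf ≠ 0 := RatFunc.X_ne_zero

theorem tq_sq_ne : tq ^ 2 - 1 ≠ 0 := by
  intro h
  have h1 : (RatFunc.X : RatFunc ℂ) ^ 4 = 1 := by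
    have := sub_eq_zero.mp h
    rw [tq, ← pow_mul] at this
    simpa using this
  have h2 : algebraMap (Polynomial ℂ) (RatFunc ℂ) (Polynomial.X ^ 4)
      = algebraMap (Polynomial ℂ) (RatFunc ℂ) 1 := by
    simpa using h1
  have h3 := RatFunc.algebraMap_injective ℂ h2
  have h4 := congrArg Polynomial.natDegree h3
  simp at h4

theorem y_boson (a : I → I → ℤ) (i j : I) (m : ℤ) :
    y a i m * y a j (m + 1) = (tq ^ (a i j)) • (y a j (m + 1) * y a i m)
      + (if i = j then ((1 : F) - tq ^ 2) • (1 : Kt a) else 0) := by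
  have h := RingQuot.mkAlgHom_rel F (KtRel.boson (a := a) i j m)
  rw [map_mul, map_add, map_smul, map_mul, apply_ite (RingQuot.mkAlgHom F (KtRel a)), map_smul,
    map_one, map_zero] at h
  exact h

theorem y_comm0 (a : I → I → ℤ) {i j : I} (m : ℤ) (hh : a i j = 0) :
    y a i m * y a j m = y a j m * y a i m := by
  have h := RingQuot.mkAlgHom_rel F (KtRel.comm0 (a := a) (m := m) hh)
  rw [map_mul, map_mul] at h
  exact h

theorem Tij_y (a : I → I → ℤ) (hA : IsCartanADE a) (i j : I) (hij : a i j = -1)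
    (Ti Tj : Kt a →ₐ[F] Kt a) (hTi : TiFormula a i ⇑Ti) (hTj : TiFormula a j ⇑Tj) (m : ℤ) :
    Ti (Tj (y a i m)) = y a j m := by
  obtain ⟨hd, hsym, -, -⟩ := hA
  have hji : a j i = -1 := by rw [hsym, hij]
  have hne : j ≠ i := by rintro rfl; rw [hd] at hij; norm_num at hij
  have e1 : Ti (y a i m) = y a i (m + 1) := by
    rw [hTi i m, if_neg (by rw [hd]; norm_num), if_pos rfl]
  have e2 : Ti (y a j m) = z a i j m := by rw [hTi j m, if_pos hij]
  rw [hTj i m, if_pos hji, z, map_smul, map_sub, map_smul, map_smul, map_mul, map_mul, e1, e2, z]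
  refine aux_rank_two tHalf tq tHalf_ne rfl tq_sq_ne _ _ _ ?_ ?_
  · have := y_boson a i i m
    rw [hd, if_pos rfl] at this
    exact_mod_cast this
  · have := y_boson a j i m
    rwa [hji, if_neg hne, add_zero, zpow_neg_one] at this

theorem no_triangle (a : I → I → ℤ) (hA : IsCartanADE a) (i j k : I) (hij : a i j = -1)
    (hik : a i k = -1) (hjk : a j k = -1) : False := by
  obtain ⟨hd, hsym, -, hp⟩ := hA
  have nij : i ≠ j := by rintro rfl; rw [hd] at hij; norm_num at hij
  have nik : i ≠ k := by rintro rfl; rw [hd] at hik; norm_num at hik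
  have njk : j ≠ k := by rintro rfl; rw [hd] at hjk; norm_num at hjk
  let v : I → ℝ := Pi.single i 1 + Pi.single j 1 + Pi.single k 1
  have hv : v ≠ 0 := by
    intro h
    have := congrFun h i
    simp [v, nij, nik] at this
  have h := hp.dotProduct_mulVec_pos hv
  have hji := hsym j i
  have hki := hsym k i
  have hkj := hsym k j
  simp [v, Matrix.mulVec_add, hd, hij, hik, hjk, hji, hki, hkj] at h
  norm_num at h

theorem braid_third (a : I → I → ℤ) (hA : IsCartanADE a) (i j k : I) (hij : a i j = -1)
    (hik : a i k = -1) (hjk : a j k = 0)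
    (Ti Tj : Kt a →ₐ[F] Kt a) (hTi : TiFormula a i ⇑Ti) (hTj : TiFormula a j ⇑Tj) (m : ℤ) :
    Ti (Tj (Ti (y a k m))) = Tj (Ti (Tj (y a k m))) := by
  have hji : a j i = -1 := by rw [hA.2.1, hij]
  have njk : j ≠ k := by rintro rfl; rw [hA.1] at hjk; norm_num at hjk
  have e1 : Ti (y a k m) = z a i k m := by rw [hTi k m, if_pos hik]
  have e2 : Tj (y a k m) = y a k m := by
    rw [hTj k m, if_neg (by rw [hjk]; norm_num), if_neg njk, add_zero]
  have e3 : Tj (y a i m) = z a j i m := by rw [hTj i m, if_pos hji]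
  have e4 := Tij_y a hA i j hij Ti Tj hTi hTj m
  rw [e2, e1]
  have l : Ti (Tj (z a i k m)) = (tq - tq⁻¹)⁻¹ • (tHalf • (z a i k m * y a j m)
      - tHalf⁻¹ • (y a j m * z a i k m)) := by
    conv_lhs => rw [z]
    simp only [map_smul, map_sub, map_mul]
    rw [e4, e2, e1]
  have r : Tj (z a i k m) = (tq - tq⁻¹)⁻¹ • (tHalf • (y a k m * z a j i m)
      - tHalf⁻¹ • (z a j i m * y a k m)) := by
    conv_lhs => rw [z]
    simp only [map_smul, map_sub, map_mul]
    rw [e2, e3]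
  rw [l, r, z, z]
  exact aux_third (tHalf : F) ((tq - tq⁻¹)⁻¹) _ _ _ (y_comm0 a m hjk)

/-- if `a i j = -1`, then `T_i` and `T_j` satisfy the braid relation
`T_i ∘ T_j ∘ T_i = T_j ∘ T_i ∘ T_j`. -/
theorem statement4 {I : Type} [Fintype I] [DecidableEq I] (a : I → I → ℤ)
    (hA : IsCartanADE a) (i j : I) (hij : a i j = -1)
    (Ti Tj : Kt a →ₐ[F] Kt a) (hTi : TiFormula a i ⇑Ti) (hTj : TiFormula a j ⇑Tj) :
    Ti.comp (Tj.comp Ti) = Tj.comp (Ti.comp Tj) := by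
  have hji : a j i = -1 := by rw [hA.2.1, hij]
  have key : ∀ (k : I) (m : ℤ), Ti (Tj (Ti (y a k m))) = Tj (Ti (Tj (y a k m))) := by
    intro k m
    have sh : ∀ (i : I) (T : Kt a →ₐ[F] Kt a), TiFormula a i ⇑T →
        T (y a i m) = y a i (m + 1) := by
      intro i T h
      rw [h i m, if_neg (by rw [hA.1]; norm_num), if_pos rfl]
    by_cases hki : k = i
    · subst hki
      rw [sh _ _ hTi, Tij_y a hA _ _ hij Ti Tj hTi hTj, Tij_y a hA _ _ hij Ti Tj hTi hTj,
        sh _ _ hTj]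
    by_cases hkj : k = j
    · subst hkj
      rw [sh _ _ hTj, Tij_y a hA _ _ hji Tj Ti hTj hTi, Tij_y a hA _ _ hji Tj Ti hTj hTi,
        sh _ _ hTi]
    rcases hA.2.2.1 i k (Ne.symm hki) with h1 | h1 <;>
      rcases hA.2.2.1 j k (Ne.symm hkj) with h2 | h2
    · have e1 : Ti (y a k m) = y a k m := by
        rw [hTi k m, if_neg (by rw [h1]; norm_num), if_neg (Ne.symm hki), add_zero]
      have e2 : Tj (y a k m) = y a k m := by
        rw [hTj k m, if_neg (by rw [h2]; norm_num), if_neg (Ne.symm hkj), add_zero]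
      rw [e1, e2, e1, e2]
    · exact (braid_third a hA j i k hji h2 h1 Tj Ti hTj hTi m).symm
    · exact braid_third a hA i j k hij h1 h2 Ti Tj hTi hTj m
    · exact (no_triangle a hA i j k hij h1 h2).elim
  apply RingQuot.ringQuot_ext'
  apply FreeAlgebra.hom_ext
  funext ⟨k, m⟩
  exact key k m
end
end

section
/- Let i, j ∈ I with a(i,j) = −1, and let m, p ∈ ℤ with p > m + 1. Then in K_t(A): z(i; j,m) z(i; j,p) = t^{2·(−1)^{p−m+1}} z(i; j,p) z(i; j,m). -/
noncomputable section

variable {I : Type} [Fintype I] [DecidableEq I]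

section Helpers

variable {R : Type*} [Ring R] [Algebra F R]

theorem qc_mul_right {c d : F} {u v w : R} (h : u * v = c • (v * u))
    (h' : u * w = d • (w * u)) : u * (v * w) = (c * d) • ((v * w) * u) := by
  rw [← mul_assoc, h, smul_mul_assoc, mul_assoc v u w, h', mul_smul_comm, smul_smul, mul_assoc]

theorem qc_mul_left {c d : F} {u v w : R} (h : v * u = c • (u * v))
    (h' : w * u = d • (u * w)) : (v * w) * u = (c * d) • (u * (v * w)) := by
  rw [mul_assoc, h', mul_smul_comm, ← mul_assoc v u w, h, smul_mul_assoc, smul_smul, mul_assoc,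
    mul_comm d c]

theorem qc_comb_right {c : F} {u v w : R} (k r s : F) (h : u * v = c • (v * u))
    (h' : u * w = c • (w * u)) :
    u * (k • (r • v - s • w)) = c • ((k • (r • v - s • w)) * u) := by
  simp only [mul_smul_comm, smul_mul_assoc, mul_sub, sub_mul, h, h', smul_sub, smul_smul]
  congr 2 <;> ring

theorem qc_comb_left {c : F} {u v w : R} (k r s : F) (h : v * u = c • (u * v))
    (h' : w * u = c • (u * w)) :
    (k • (r • v - s • w)) * u = c • (u * (k • (r • v - s • w))) := by
  simp only [mul_smul_comm, smul_mul_assoc, mul_sub, sub_mul, h, h', smul_sub, smul_smul]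
  congr 2 <;> ring

end Helpers

theorem y_tcomm (a : I → I → ℤ) (i j : I) {m p : ℤ} (h : p > m + 1) :
    y a i m * y a j p =
      (tq ^ ((((-1 : ℤˣ) ^ (p - m + 1) : ℤˣ) : ℤ) * a i j)) • (y a j p * y a i m) := by
  have := RingQuot.mkAlgHom_rel F (KtRel.tcomm (a := a) (i := i) (j := j) h)
  simp only [map_mul, map_smul] at this
  exact this

theorem tq_ne_zero : tq ≠ 0 := pow_ne_zero _ RatFunc.X_ne_zero

/-- for `a i j = -1` and `p > m + 1`,
`z(i;j,m) z(i;j,p) = t^{2·(−1)^{p−m+1}} z(i;j,p) z(i;j,m)`. -/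
theorem statement16 {I : Type} [Fintype I] [DecidableEq I] (a : I → I → ℤ)
    (hA : IsCartanADE a) (i j : I) (hij : a i j = -1) (m p : ℤ) (hp : p > m + 1) :
    z a i j m * z a i j p
      = (tq ^ (2 * ((((-1 : ℤˣ) ^ (p - m + 1) : ℤˣ) : ℤ)))) •
          (z a i j p * z a i j m) := by
  obtain ⟨hd, hs, -, -⟩ := hA
  have hji : a j i = -1 := by rw [hs, hij]
  generalize hE : (((-1 : ℤˣ) ^ (p - m + 1) : ℤˣ) : ℤ) = e
  have key : ∀ k l, y a k m * y a l p = tq ^ (e * a k l) • (y a l p * y a k m) := by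
    intro k l
    rw [← hE]
    exact y_tcomm a k l hp
  have hi : y a i m * z a i j p = tq ^ e • (z a i j p * y a i m) := by
    have h1 := qc_mul_right (key i j) (key i i)
    have h2 := qc_mul_right (key i i) (key i j)
    rw [← zpow_add₀ tq_ne_zero, hd, hij, show e * -1 + e * 2 = e by ring] at h1
    rw [← zpow_add₀ tq_ne_zero, hd, hij, show e * 2 + e * -1 = e by ring] at h2
    exact qc_comb_right _ _ _ h1 h2
  have hj : y a j m * z a i j p = tq ^ e • (z a i j p * y a j m) := by
    have h1 := qc_mul_right (key j j) (key j i)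
    have h2 := qc_mul_right (key j i) (key j j)
    rw [← zpow_add₀ tq_ne_zero, hd, hji, show e * 2 + e * -1 = e by ring] at h1
    rw [← zpow_add₀ tq_ne_zero, hd, hji, show e * -1 + e * 2 = e by ring] at h2
    exact qc_comb_right _ _ _ h1 h2
  have h1 := qc_mul_left hj hi
  have h2 := qc_mul_left hi hj
  rw [← zpow_add₀ tq_ne_zero, ← two_mul] at h1 h2
  exact qc_comb_left _ _ _ h1 h2
end
end
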